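/- Derivative formula for the localized momentum. Let τ > 0 and χ(x) := (1/2)(1 + tanh(τx/2)). Let I ⊂ ℝ be an open interval, R̃ ∈ C¹(I), and let (η, v) be a classical solution of (NLS_hy) on I × ℝ with η < 1 everywhere, such that η is C¹ in t and C³ in x, v is C¹ in t and C² in x, and for each compact J ⊂ I, sup_{t∈J} (1+x²)(|η| + |∂_xη| + |∂_x²η| + |∂_x³η| + |v| + |∂_xv| + |∂_x²v| + |∂_tη| + |∂_tv|)(t,x) → 0 as |x| → ∞. Define p(t) := (1/2)∫_ℝ η(t,x) v(t,x) χ(x − R̃(t)) dx. Then p is differentiable on I and p'(t) = ∫_ℝ [ (1/2) χ'(x−R̃(t)) ( (1−2η)v² + F̃(η) + (3−2η)(∂_xη)²/(4(1−η)²) − R̃'(t) η v ) + (1/4) χ'''(x−R̃(t)) ( η + ln(1−η) ) ](t,x) dx, where F̃(ρ) := ρ f(1−ρ) − F(1−ρ). -/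

import Mathlib

open MeasureTheory Real Filter Topology Set intervalIntegral

noncomputable section

/-- The primitive `F(ρ) = ∫_ρ^1 f(r) dr`. -/
def Fprim (f : ℝ → ℝ) (ρ : ℝ) : ℝ := ∫ r in ρ..1, f r

/-- The auxiliary nonlinearity `F̃(ρ) = ρ f(1−ρ) − F(1−ρ)`. -/
def Ftil (f : ℝ → ℝ) (ρ : ℝ) : ℝ := ρ * f (1 - ρ) - Fprim f (1 - ρ)

/-- The cut-off function `χ(x) = (1/2)(1 + tanh(τ x / 2))`. -/
def cutoff (τ : ℝ) (x : ℝ) : ℝ := (1 / 2) * (1 + Real.tanh (τ / 2 * x))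

/-- The pair `(η, v)` solves `(NLS_hy)` classically at `(t, x)`. -/
def SolvesNLShyAt (f : ℝ → ℝ) (η v : ℝ → ℝ → ℝ) (t x : ℝ) : Prop :=
  deriv (fun s => η s x) t = -2 * deriv (fun y => v t y * (1 - η t y)) x ∧
  deriv (fun s => v s x) t =
    - deriv (fun y =>
        f (1 - η t y) - (v t y) ^ 2
          - iteratedDeriv 2 (fun z => η t z) y / (2 * (1 - η t y))
          - (deriv (fun z => η t z) y) ^ 2 / (4 * (1 - η t y) ^ 2)) x

theorem hasDerivAt_tanh_scaled (τ x : ℝ) :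
    HasDerivAt (fun y => Real.tanh (τ / 2 * y)) (τ / 2 * (1 - Real.tanh (τ / 2 * x) ^ 2)) x := by
  have h0 : HasDerivAt (fun y : ℝ => τ / 2 * y) (τ / 2) x := by
    simpa using (hasDerivAt_id x).const_mul (τ / 2)
  have hs := h0.sinh
  have hc := h0.cosh
  have hne : Real.cosh (τ / 2 * x) ≠ 0 := (Real.cosh_pos _).ne'
  have h := hs.div hc hne
  have e : (fun y => Real.tanh (τ / 2 * y))
      = (fun y => Real.sinh (τ / 2 * y)) / (fun y => Real.cosh (τ / 2 * y)) := by
    funext y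
    simp [Real.tanh_eq_sinh_div_cosh]
  rw [e]
  refine h.congr_deriv ?_
  rw [Real.tanh_eq_sinh_div_cosh]
  field_simp

/-- first derivative of the cutoff -/
def cut1 (τ x : ℝ) : ℝ := τ / 4 * (1 - Real.tanh (τ / 2 * x) ^ 2)
/-- second derivative of the cutoff -/
def cut2 (τ x : ℝ) : ℝ :=
  -(τ ^ 2 / 4) * (Real.tanh (τ / 2 * x) * (1 - Real.tanh (τ / 2 * x) ^ 2))
/-- third derivative of the cutoff -/
def cut3 (τ x : ℝ) : ℝ :=
  -(τ ^ 2 / 2) * (1 - 3 * Real.tanh (τ / 2 * x) ^ 2) * cut1 τ x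

theorem hasDerivAt_cut0 (τ x : ℝ) : HasDerivAt (cutoff τ) (cut1 τ x) x := by
  have h := ((hasDerivAt_tanh_scaled τ x).const_add 1).const_mul (1 / 2)
  refine h.congr_deriv ?_
  unfold cut1; ring

theorem hasDerivAt_cut1 (τ x : ℝ) : HasDerivAt (cut1 τ) (cut2 τ x) x := by
  have h := (((hasDerivAt_tanh_scaled τ x).fun_pow 2).const_sub 1).const_mul (τ / 4)
  refine h.congr_deriv ?_
  unfold cut2; push_cast; ring

theorem hasDerivAt_cut2 (τ x : ℝ) : HasDerivAt (cut2 τ) (cut3 τ x) x := by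
  have h1 := (((hasDerivAt_tanh_scaled τ x).fun_pow 2).const_sub 1)
  have h := ((hasDerivAt_tanh_scaled τ x).fun_mul h1).const_mul (-(τ ^ 2 / 4))
  refine h.congr_deriv ?_
  unfold cut3 cut1; push_cast; ring

theorem deriv_cutoff (τ : ℝ) : deriv (cutoff τ) = cut1 τ :=
  funext fun x => (hasDerivAt_cut0 τ x).deriv

theorem iteratedDeriv_cutoff (τ : ℝ) : iteratedDeriv 3 (cutoff τ) = cut3 τ := by
  have h1 : deriv (cut1 τ) = cut2 τ := funext fun x => (hasDerivAt_cut1 τ x).deriv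
  have h2 : deriv (cut2 τ) = cut3 τ := funext fun x => (hasDerivAt_cut2 τ x).deriv
  rw [iteratedDeriv_succ, iteratedDeriv_succ, iteratedDeriv_one, deriv_cutoff, h1, h2]

theorem tanh_sq_le (u : ℝ) : Real.tanh u ^ 2 ≤ 1 := by
  have h := (Real.abs_tanh_lt_one u).le
  rw [← sq_abs]
  have := abs_nonneg (Real.tanh u)
  nlinarith

theorem cut0_bound (τ x : ℝ) : |cutoff τ x| ≤ 1 := by
  have h := abs_le.1 (Real.abs_tanh_lt_one (τ / 2 * x)).le
  unfold cutoff
  rw [abs_le]; constructor <;> linarith [h.1, h.2]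

theorem cut1_bound (τ x : ℝ) : |cut1 τ x| ≤ |τ / 4| := by
  unfold cut1
  rw [abs_mul]
  refine mul_le_of_le_one_right (abs_nonneg _) ?_
  have h := tanh_sq_le (τ / 2 * x)
  have h' := sq_nonneg (Real.tanh (τ / 2 * x))
  rw [abs_le]; constructor <;> linarith

theorem cut2_bound (τ x : ℝ) : |cut2 τ x| ≤ τ ^ 2 / 4 := by
  unfold cut2
  rw [abs_mul, abs_neg, abs_of_nonneg (by positivity : 0 ≤ τ ^ 2 / 4), abs_mul]
  refine mul_le_of_le_one_right (by positivity) ?_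
  have h := tanh_sq_le (τ / 2 * x)
  have h' := sq_nonneg (Real.tanh (τ / 2 * x))
  refine mul_le_one₀ (Real.abs_tanh_lt_one _).le (abs_nonneg _) ?_
  rw [abs_le]; constructor <;> linarith

theorem continuous_tanh_scaled (τ : ℝ) : Continuous (fun y => Real.tanh (τ / 2 * y)) :=
  continuous_iff_continuousAt.2 fun x => (hasDerivAt_tanh_scaled τ x).continuousAt

theorem one_sub_tanh_sq_le (u : ℝ) : 1 - Real.tanh u ^ 2 ≤ (1 + u ^ 2)⁻¹ := by
  have hc := Real.cosh_pos u
  have e : 1 - Real.tanh u ^ 2 = (Real.cosh u ^ 2)⁻¹ := by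
    rw [Real.tanh_eq_sinh_div_cosh]
    field_simp
    linarith [Real.cosh_sq u]
  rw [e]
  apply inv_anti₀ (by positivity)
  rw [Real.cosh_sq']
  have : u ^ 2 ≤ Real.sinh u ^ 2 := by
    rcases le_total 0 u with h | h
    · have := Real.self_le_sinh_iff.2 h
      nlinarith
    · have := Real.sinh_le_self_iff.2 h
      nlinarith
  linarith

theorem integrable_cut1 (τ : ℝ) (hτ : 0 < τ) : Integrable (cut1 τ) := by
  have h := (integrable_inv_one_add_sq.comp_mul_left' (R := τ / 2) (by positivity)).const_mul (τ / 4)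
  refine h.mono' ?_ (Eventually.of_forall fun x => ?_)
  · exact (continuous_iff_continuousAt.2
      fun x => (hasDerivAt_cut1 τ x).continuousAt).aestronglyMeasurable
  · have h0 := tanh_sq_le (τ / 2 * x)
    unfold cut1
    rw [Real.norm_eq_abs, abs_of_nonneg (mul_nonneg (by positivity) (by linarith))]
    exact mul_le_mul_of_nonneg_left (one_sub_tanh_sq_le _) (by positivity)

theorem integrable_cut3 (τ : ℝ) (hτ : 0 < τ) : Integrable (cut3 τ) := by
  have hc := continuous_tanh_scaled τ
  refine (integrable_cut1 τ hτ).bdd_mul (c := τ ^ 2 / 2 * 2)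
    (f := fun x => -(τ ^ 2 / 2) * (1 - 3 * Real.tanh (τ / 2 * x) ^ 2))
    (Continuous.aestronglyMeasurable (by fun_prop)) (Eventually.of_forall fun x => ?_)
  have h := tanh_sq_le (τ / 2 * x)
  have h' := sq_nonneg (Real.tanh (τ / 2 * x))
  rw [Real.norm_eq_abs, abs_mul, abs_neg, abs_of_nonneg (by positivity : 0 ≤ τ ^ 2 / 2)]
  refine mul_le_mul_of_nonneg_left ?_ (by positivity)
  rw [abs_le]; constructor <;> linarith

theorem hasDerivAt_Fprim (f : ℝ → ℝ) (hf : ContDiffOn ℝ 3 f (Set.Ici 0)) (r : ℝ) (hr : 0 < r) :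
    HasDerivAt (Fprim f) (-f r) r := by
  have hc := hf.continuousOn
  refine intervalIntegral.integral_hasDerivAt_left ?_ ?_ ?_
  · apply ContinuousOn.intervalIntegrable
    refine hc.mono fun y hy => ?_
    exact le_trans (le_min hr.le zero_le_one) hy.1
  · exact ContinuousOn.stronglyMeasurableAtFilter isOpen_Ioi (hc.mono Ioi_subset_Ici_self) r hr
  · exact hc.continuousAt (Ici_mem_nhds hr)

theorem hasDerivAt_f (f : ℝ → ℝ) (hf : ContDiffOn ℝ 3 f (Set.Ici 0)) (r : ℝ) (hr : 0 < r) :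
    HasDerivAt f (deriv f r) r :=
  ((hf.differentiableOn (by norm_num)).differentiableAt (Ici_mem_nhds hr)).hasDerivAt

theorem hasDerivAt_Ftil (f : ℝ → ℝ) (hf : ContDiffOn ℝ 3 f (Set.Ici 0)) (ρ : ℝ) (hr : ρ < 1) :
    HasDerivAt (Ftil f) (-ρ * deriv f (1 - ρ)) ρ := by
  have h0 : HasDerivAt (fun y : ℝ => 1 - y) (-1) ρ := (hasDerivAt_id ρ).const_sub 1
  have h1 := (hasDerivAt_f f hf (1 - ρ) (by linarith)).comp ρ h0
  have h2 := (hasDerivAt_Fprim f hf (1 - ρ) (by linarith)).comp ρ h0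
  have h := ((hasDerivAt_id ρ).mul h1).sub h2
  refine h.congr_deriv ?_
  simp

theorem Ftil_zero (f : ℝ → ℝ) : Ftil f 0 = 0 := by simp [Ftil, Fprim]

/-- the flux -/
def fluxW (f e e1 e2 w : ℝ → ℝ) (x : ℝ) : ℝ :=
  (1 - 2 * e x) * w x ^ 2 + Ftil f (e x)
    - e x * (e2 x / (2 * (1 - e x)) + e1 x ^ 2 / (4 * (1 - e x) ^ 2))
    + e1 x ^ 2 / (4 * (1 - e x))

/-- the total boundary term -/
def bdry (f e e1 e2 w c0 c1 c2 : ℝ → ℝ) (x : ℝ) : ℝ :=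
  1 / 2 * (c0 x * fluxW f e e1 e2 w x) + 1 / 4 * (c1 x * (e x * e1 x / (1 - e x)))
    + 1 / 4 * (c2 x * (e x + Real.log (1 - e x)))

theorem core_deriv (f : ℝ → ℝ) (hf : ContDiffOn ℝ 3 f (Set.Ici 0))
    (e e1 e2 e3 w w1 et wt c0 c1 c2 c3 : ℝ → ℝ)
    (he : ∀ x, HasDerivAt e (e1 x) x) (he1 : ∀ x, HasDerivAt e1 (e2 x) x)
    (he2 : ∀ x, HasDerivAt e2 (e3 x) x) (hw : ∀ x, HasDerivAt w (w1 x) x)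
    (hlt : ∀ x, e x < 1)
    (h1 : ∀ x, et x = -2 * deriv (fun y => w y * (1 - e y)) x)
    (h2 : ∀ x, wt x = - deriv (fun y => f (1 - e y) - (w y) ^ 2 - e2 y / (2 * (1 - e y))
          - (e1 y) ^ 2 / (4 * (1 - e y) ^ 2)) x)
    (hc0 : ∀ x, HasDerivAt c0 (c1 x) x) (hc1 : ∀ x, HasDerivAt c1 (c2 x) x)
    (hc2 : ∀ x, HasDerivAt c2 (c3 x) x) (r : ℝ) (x : ℝ) :
    HasDerivAt (bdry f e e1 e2 w c0 c1 c2)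
      ((1 / 2 * c1 x * ((1 - 2 * e x) * w x ^ 2 + Ftil f (e x)
          + (3 - 2 * e x) * e1 x ^ 2 / (4 * (1 - e x) ^ 2) - r * (e x * w x))
        + 1 / 4 * c3 x * (e x + Real.log (1 - e x)))
       - 1 / 2 * ((et x * w x + e x * wt x) * c0 x - e x * w x * (c1 x * r))) x := by
  have hpos : 0 < 1 - e x := by linarith [hlt x]
  have hne : 1 - e x ≠ 0 := hpos.ne'
  have hu : HasDerivAt (fun y => 1 - e y) (-e1 x) x := (he x).const_sub 1
  have hf' := (hasDerivAt_f f hf (1 - e x) hpos).comp x hu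
  have hF := (hasDerivAt_Ftil f hf (e x) (hlt x)).comp x (he x)
  have hA := (he2 x).fun_div (hu.const_mul 2) (by simpa using hne)
  have hB := ((he1 x).fun_pow 2).fun_div ((hu.fun_pow 2).const_mul 4) (by simpa using hne)
  have hC := ((he1 x).fun_pow 2).fun_div (hu.const_mul 4) (by simpa using hne)
  have e1' := h1 x
  rw [((hw x).fun_mul hu).deriv] at e1'
  have e2' := h2 x
  have hG := ((hf'.fun_sub ((hw x).fun_pow 2)).fun_sub hA).fun_sub hB
  have hGd := hG.deriv
  simp only [Function.comp_apply] at hGd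
  rw [hGd] at e2'
  have hW := (((((he x).const_mul 2).const_sub 1).fun_mul ((hw x).fun_pow 2)).fun_add hF).fun_sub
    ((he x).fun_mul (hA.fun_add hB)) |>.fun_add hC
  have hL := (he x).fun_add (hu.log hne)
  have hM := ((he x).fun_mul (he1 x)).fun_div hu hne
  have hT := ((((hc0 x).fun_mul hW).const_mul (1 / 2)).fun_add
    (((hc1 x).fun_mul hM).const_mul (1 / 4))).fun_add (((hc2 x).fun_mul hL).const_mul (1 / 4))
  refine HasDerivAt.congr_deriv (f := bdry f e e1 e2 w c0 c1 c2) hT ?_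
  rw [e1', e2']
  simp only [Function.comp_apply]
  generalize Real.log (1 - e x) = lg
  generalize deriv f (1 - e x) = fd
  generalize Ftil f (e x) = Fd
  push_cast
  obtain ⟨u, hu'⟩ : ∃ u, u = 1 - e x := ⟨_, rfl⟩
  have hex : e x = 1 - u := by linarith
  rw [hex] at hne ⊢
  have hune : u ≠ 0 := by simpa using hne
  rw [show 1 - (1 - u) = u by ring]
  field_simp
  ring

theorem core_tendsto (f : ℝ → ℝ) (hf : ContDiffOn ℝ 3 f (Set.Ici 0))
    (e e1 e2 w c0 c1 c2 : ℝ → ℝ) (l : Filter ℝ) (C : ℝ)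
    (he : Tendsto e l (𝓝 0)) (he1 : Tendsto e1 l (𝓝 0)) (he2 : Tendsto e2 l (𝓝 0))
    (hw : Tendsto w l (𝓝 0))
    (hc0 : ∀ x, |c0 x| ≤ C) (hc1 : ∀ x, |c1 x| ≤ C) (hc2 : ∀ x, |c2 x| ≤ C) :
    Tendsto (bdry f e e1 e2 w c0 c1 c2) l (𝓝 0) := by
  have hF : Tendsto (fun x => Ftil f (e x)) l (𝓝 0) := by
    have := (hasDerivAt_Ftil f hf 0 one_pos).continuousAt.tendsto.comp he
    rwa [Ftil_zero] at this
  have hu : Tendsto (fun x => 1 - e x) l (𝓝 1) := by simpa using he.const_sub 1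
  have hlog : Tendsto (fun x => e x + Real.log (1 - e x)) l (𝓝 0) := by
    simpa using he.add (hu.log one_ne_zero)
  have hM : Tendsto (fun x => e x * e1 x / (1 - e x)) l (𝓝 0) := by
    have := (he.mul he1).div hu one_ne_zero
    simp only [zero_mul, zero_div] at this
    exact this
  have hW : Tendsto (fluxW f e e1 e2 w) l (𝓝 0) := by
    have := ((((he.const_mul 2).const_sub 1).mul (hw.pow 2)).add hF).sub
      (he.mul ((he2.div (hu.const_mul 2) (by norm_num)).add
        ((he1.pow 2).div ((hu.pow 2).const_mul 4) (by norm_num)))) |>.add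
        ((he1.pow 2).div (hu.const_mul 4) (by norm_num))
    have h0 : (1 - 2 * (0:ℝ)) * 0 ^ 2 + 0 - 0 * (0 / (2 * 1) + 0 ^ 2 / (4 * 1 ^ 2))
        + 0 ^ 2 / (4 * 1) = 0 := by norm_num
    rw [h0] at this
    exact this
  have key : ∀ c g : ℝ → ℝ, (∀ x, |c x| ≤ C) → Tendsto g l (𝓝 0) →
      Tendsto (fun x => c x * g x) l (𝓝 0) := by
    intro c g hc hg
    refine squeeze_zero_norm (a := fun x => C * |g x|) (fun x => ?_) ?_
    · rw [Real.norm_eq_abs, abs_mul]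
      exact mul_le_mul_of_nonneg_right (hc x) (abs_nonneg _)
    · simpa using hg.abs.const_mul C
  have := (((key c0 _ hc0 hW).const_mul (1 / 2)).add ((key c1 _ hc1 hM).const_mul (1 / 4))).add
    ((key c2 _ hc2 hlog).const_mul (1 / 4))
  have h0 : 1 / 2 * (0:ℝ) + 1 / 4 * 0 + 1 / 4 * 0 = 0 := by norm_num
  rw [h0] at this
  exact this

theorem bounded_of_tendsto (g : ℝ → ℝ) (hg : Continuous g) (h : Tendsto g (cocompact ℝ) (𝓝 0)) :
    ∃ C, ∀ x, ‖g x‖ ≤ C := by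
  have h1 : ∀ᶠ x in cocompact ℝ, ‖g x‖ ≤ 1 := by
    have := h.norm
    rw [norm_zero] at this
    exact this.eventually_le_const one_pos
  obtain ⟨K, hK, hKs⟩ := mem_cocompact.1 h1
  obtain ⟨C, hC⟩ := hK.exists_bound_of_continuousOn hg.continuousOn
  refine ⟨max C 1, fun x => ?_⟩
  by_cases hx : x ∈ K
  · exact (hC x hx).trans (le_max_left _ _)
  · exact (hKs hx : ‖g x‖ ≤ 1).trans (le_max_right _ _)

theorem core_integrable (f : ℝ → ℝ) (hf : ContDiffOn ℝ 3 f (Set.Ici 0))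
    (e e1 w c1 c3 : ℝ → ℝ) (r : ℝ)
    (hce : Continuous e) (hce1 : Continuous e1) (hcw : Continuous w)
    (hlt : ∀ x, e x < 1)
    (he : Tendsto e (cocompact ℝ) (𝓝 0)) (he1 : Tendsto e1 (cocompact ℝ) (𝓝 0))
    (hw : Tendsto w (cocompact ℝ) (𝓝 0)) (hc1 : Integrable c1) (hc3 : Integrable c3) :
    Integrable (fun x => 1 / 2 * c1 x * ((1 - 2 * e x) * w x ^ 2 + Ftil f (e x)
          + (3 - 2 * e x) * e1 x ^ 2 / (4 * (1 - e x) ^ 2) - r * (e x * w x))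
        + 1 / 4 * c3 x * (e x + Real.log (1 - e x))) := by
  have hF : Tendsto (fun x => Ftil f (e x)) (cocompact ℝ) (𝓝 0) := by
    have := (hasDerivAt_Ftil f hf 0 one_pos).continuousAt.tendsto.comp he
    rwa [Ftil_zero] at this
  have hu : Tendsto (fun x => 1 - e x) (cocompact ℝ) (𝓝 1) := by simpa using he.const_sub 1
  have hne : ∀ x, 1 - e x ≠ 0 := fun x => by linarith [hlt x]
  have hFc : Continuous (fun x => Ftil f (e x)) := continuous_iff_continuousAt.2 fun x =>
    (hasDerivAt_Ftil f hf (e x) (hlt x)).continuousAt.comp hce.continuousAt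
  obtain ⟨C, hC⟩ := bounded_of_tendsto (fun x => e x + Real.log (1 - e x))
    (hce.add ((continuous_const.sub hce).log hne)) (by simpa using he.add (hu.log one_ne_zero))
  obtain ⟨D, hD⟩ := bounded_of_tendsto (fun x => (1 - 2 * e x) * w x ^ 2 + Ftil f (e x)
          + (3 - 2 * e x) * e1 x ^ 2 / (4 * (1 - e x) ^ 2) - r * (e x * w x))
    (by
      have : Continuous (fun x => (3 - 2 * e x) * e1 x ^ 2 / (4 * (1 - e x) ^ 2)) :=
        Continuous.div (by fun_prop) (by fun_prop) (fun x => by simpa using hne x)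
      fun_prop)
    (by
      have := ((((he.const_mul 2).const_sub 1).mul (hw.pow 2)).add hF).add
        ((((he.const_mul 2).const_sub 3).mul (he1.pow 2)).div ((hu.pow 2).const_mul 4)
          (by norm_num)) |>.sub ((he.mul hw).const_mul r)
      simpa using this)
  refine Integrable.add ?_ ?_
  · refine (hc1.const_mul (1 / 2)).mul_bdd (c := D) ?_ (Eventually.of_forall hD)
    apply Continuous.aestronglyMeasurable
    have : Continuous (fun x => (3 - 2 * e x) * e1 x ^ 2 / (4 * (1 - e x) ^ 2)) :=
      Continuous.div (by fun_prop) (by fun_prop) (fun x => by simpa using hne x)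
    fun_prop
  · refine (hc3.const_mul (1 / 4)).mul_bdd (c := C) ?_ (Eventually.of_forall hC)
    exact (hce.add ((continuous_const.sub hce).log hne)).aestronglyMeasurable

theorem unif_bound (J : Set ℝ) (hJ : IsCompact J) (g : ℝ → ℝ → ℝ)
    (hg : ContinuousOn (fun p : ℝ × ℝ => g p.1 p.2) (J ×ˢ Set.univ)) (R : ℝ)
    (h : ∀ t ∈ J, ∀ x : ℝ, R ≤ |x| → (1 + x ^ 2) * |g t x| ≤ 1) :
    ∃ C, 0 ≤ C ∧ ∀ t ∈ J, ∀ x, |g t x| ≤ C * (1 + x ^ 2)⁻¹ := by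
  have hK : IsCompact (J ×ˢ Set.Icc (-R) R) := hJ.prod isCompact_Icc
  have hc : ContinuousOn (fun p : ℝ × ℝ => (1 + p.2 ^ 2) * g p.1 p.2) (J ×ˢ Set.Icc (-R) R) :=
    ContinuousOn.mul (Continuous.continuousOn (by fun_prop))
      (hg.mono (Set.prod_mono le_rfl (Set.subset_univ _)))
  obtain ⟨C, hC⟩ := hK.exists_bound_of_continuousOn hc
  refine ⟨max C 1, le_trans zero_le_one (le_max_right _ _), fun t ht x => ?_⟩
  have hp : 0 < 1 + x ^ 2 := by positivity
  rw [← div_eq_mul_inv, le_div_iff₀ hp, mul_comm]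
  rcases le_total R |x| with hx | hx
  · exact (h t ht x hx).trans (le_max_right _ _)
  · have := hC (t, x) ⟨ht, abs_le.1 hx⟩
    simp only [Real.norm_eq_abs, abs_mul, abs_of_pos hp] at this
    exact this.trans (le_max_left _ _)

theorem tendsto_of_bound (g : ℝ → ℝ) (C : ℝ) (h : ∀ x, |g x| ≤ C * (1 + x ^ 2)⁻¹) :
    Tendsto g (cocompact ℝ) (𝓝 0) := by
  refine squeeze_zero_norm (a := fun x => C * (1 + x ^ 2)⁻¹) (fun x => h x) ?_
  have h1 : Tendsto (fun x : ℝ => 1 + x ^ 2) (cocompact ℝ) atTop := by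
    have := (tendsto_pow_atTop (α := ℝ) two_ne_zero).comp (tendsto_norm_cocompact_atTop (E := ℝ))
    refine tendsto_atTop_add_const_left _ 1 (this.congr fun x => ?_)
    simp
  simpa using (tendsto_inv_atTop_zero.comp h1).const_mul C

/-- **Derivative formula for the localized momentum**
(the identity underlying Proposition 3.6 of the paper): for a classical decaying solution of
`(NLS_hy)` and a `C¹` translation path `R̃`, the localized momentum
`p(t) = (1/2)∫ η v χ(· − R̃(t))` is differentiable, with the stated derivative. -/
theorem localized_momentum_derivative
    (f : ℝ → ℝ) (hf : ContDiffOn ℝ 3 f (Set.Ici 0)) (hf1 : f 1 = 0)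
    (τ : ℝ) (hτ : 0 < τ)
    (I : Set ℝ) (hI : IsOpen I) (hIconn : I.OrdConnected)
    (Rtil : ℝ → ℝ) (hR : ∀ t ∈ I, DifferentiableAt ℝ Rtil t)
    (hR' : ContinuousOn (deriv Rtil) I)
    (η v : ℝ → ℝ → ℝ)
    (hlt : ∀ t ∈ I, ∀ x : ℝ, η t x < 1)
    -- regularity: `η` C¹ in `t`, C³ in `x`; `v` C¹ in `t`, C² in `x`
    (hηx : ∀ t ∈ I, ContDiff ℝ 3 (fun x => η t x))
    (hvx : ∀ t ∈ I, ContDiff ℝ 2 (fun x => v t x))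
    (hηt : ∀ x : ℝ, ∀ t ∈ I, DifferentiableAt ℝ (fun s => η s x) t)
    (hvt : ∀ x : ℝ, ∀ t ∈ I, DifferentiableAt ℝ (fun s => v s x) t)
    (hηt_cont : ContinuousOn (fun p : ℝ × ℝ => deriv (fun s => η s p.2) p.1) (I ×ˢ Set.univ))
    (hvt_cont : ContinuousOn (fun p : ℝ × ℝ => deriv (fun s => v s p.2) p.1) (I ×ˢ Set.univ))
    (hηx_cont : ∀ k ≤ 3,
      ContinuousOn (fun p : ℝ × ℝ => iteratedDeriv k (fun y => η p.1 y) p.2) (I ×ˢ Set.univ))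
    (hvx_cont : ∀ k ≤ 2,
      ContinuousOn (fun p : ℝ × ℝ => iteratedDeriv k (fun y => v p.1 y) p.2) (I ×ˢ Set.univ))
    -- spatial decay, locally uniform in time
    (hdecay : ∀ J : Set ℝ, IsCompact J → J ⊆ I → ∀ ε > (0:ℝ), ∃ R : ℝ, ∀ t ∈ J, ∀ x : ℝ,
      R ≤ |x| →
      (1 + x ^ 2) *
        (|η t x| + |deriv (fun y => η t y) x| + |iteratedDeriv 2 (fun y => η t y) x|
          + |iteratedDeriv 3 (fun y => η t y) x| + |v t x| + |deriv (fun y => v t y) x|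
          + |iteratedDeriv 2 (fun y => v t y) x|
          + |deriv (fun s => η s x) t| + |deriv (fun s => v s x) t|) ≤ ε)
    -- `(η, v)` solves `(NLS_hy)` on `I × ℝ`
    (hsol : ∀ t ∈ I, ∀ x : ℝ, SolvesNLShyAt f η v t x) :
    ∀ t ∈ I, HasDerivAt
      (fun s => (1 / 2) * ∫ x : ℝ, η s x * v s x * cutoff τ (x - Rtil s))
      (∫ x : ℝ,
        (1 / 2) * deriv (cutoff τ) (x - Rtil t) *
          ((1 - 2 * η t x) * (v t x) ^ 2 + Ftil f (η t x)
            + (3 - 2 * η t x) * (deriv (fun y => η t y) x) ^ 2 / (4 * (1 - η t x) ^ 2)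
            - deriv Rtil t * (η t x * v t x))
        + (1 / 4) * iteratedDeriv 3 (cutoff τ) (x - Rtil t) *
            (η t x + Real.log (1 - η t x))) t := by
  intro t ht
  obtain ⟨ρ, hρ, hρI⟩ := Metric.nhds_basis_closedBall.mem_iff.1 (hI.mem_nhds ht)
  set J := Metric.closedBall t ρ with hJdef
  have hJ : IsCompact J := isCompact_closedBall t ρ
  have hJn : J ∈ 𝓝 t := Metric.closedBall_mem_nhds t hρ
  have htJ : t ∈ J := mem_of_mem_nhds hJn
  obtain ⟨R, hRd⟩ := hdecay J hJ hρI 1 one_pos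
  have hsub : J ×ˢ (Set.univ : Set ℝ) ⊆ I ×ˢ Set.univ := Set.prod_mono hρI le_rfl
  have small : ∀ (s : ℝ) (a S x : ℝ), a ≤ S → (1 + x ^ 2) * S ≤ 1 → (1 + x ^ 2) * a ≤ 1 := by
    intro s a S x h h'
    exact (mul_le_mul_of_nonneg_left h (by positivity)).trans h'
  obtain ⟨Ce, hCe0, hCe⟩ := unif_bound J hJ η
    (by simpa only [iteratedDeriv_zero] using (hηx_cont 0 (by norm_num)).mono hsub) R
    (fun s hs x hx => small s _ _ x (by
      linarith [abs_nonneg (η s x), abs_nonneg (deriv (fun y => η s y) x), abs_nonneg (iteratedDeriv 2 (fun y => η s y) x), abs_nonneg (iteratedDeriv 3 (fun y => η s y) x), abs_nonneg (v s x), abs_nonneg (deriv (fun y => v s y) x), abs_nonneg (iteratedDeriv 2 (fun y => v s y) x), abs_nonneg (deriv (fun r => η r x) s), abs_nonneg (deriv (fun r => v r x) s)]) (hRd s hs x hx))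
  obtain ⟨Cv, hCv0, hCv⟩ := unif_bound J hJ v
    (by simpa only [iteratedDeriv_zero] using (hvx_cont 0 (by norm_num)).mono hsub) R
    (fun s hs x hx => small s _ _ x (by
      linarith [abs_nonneg (η s x), abs_nonneg (deriv (fun y => η s y) x), abs_nonneg (iteratedDeriv 2 (fun y => η s y) x), abs_nonneg (iteratedDeriv 3 (fun y => η s y) x), abs_nonneg (v s x), abs_nonneg (deriv (fun y => v s y) x), abs_nonneg (iteratedDeriv 2 (fun y => v s y) x), abs_nonneg (deriv (fun r => η r x) s), abs_nonneg (deriv (fun r => v r x) s)]) (hRd s hs x hx))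
  obtain ⟨Ce1, hCe10, hCe1⟩ := unif_bound J hJ (fun s x => deriv (fun y => η s y) x)
    (by simpa only [iteratedDeriv_one] using (hηx_cont 1 (by norm_num)).mono hsub) R
    (fun s hs x hx => small s _ _ x (by
      linarith [abs_nonneg (η s x), abs_nonneg (deriv (fun y => η s y) x), abs_nonneg (iteratedDeriv 2 (fun y => η s y) x), abs_nonneg (iteratedDeriv 3 (fun y => η s y) x), abs_nonneg (v s x), abs_nonneg (deriv (fun y => v s y) x), abs_nonneg (iteratedDeriv 2 (fun y => v s y) x), abs_nonneg (deriv (fun r => η r x) s), abs_nonneg (deriv (fun r => v r x) s)]) (hRd s hs x hx))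
  obtain ⟨Ce2, hCe20, hCe2⟩ := unif_bound J hJ (fun s x => iteratedDeriv 2 (fun y => η s y) x)
    ((hηx_cont 2 (by norm_num)).mono hsub) R
    (fun s hs x hx => small s _ _ x (by
      linarith [abs_nonneg (η s x), abs_nonneg (deriv (fun y => η s y) x), abs_nonneg (iteratedDeriv 2 (fun y => η s y) x), abs_nonneg (iteratedDeriv 3 (fun y => η s y) x), abs_nonneg (v s x), abs_nonneg (deriv (fun y => v s y) x), abs_nonneg (iteratedDeriv 2 (fun y => v s y) x), abs_nonneg (deriv (fun r => η r x) s), abs_nonneg (deriv (fun r => v r x) s)]) (hRd s hs x hx))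
  obtain ⟨Cet, hCet0, hCet⟩ := unif_bound J hJ (fun s x => deriv (fun r => η r x) s)
    (hηt_cont.mono hsub) R
    (fun s hs x hx => small s _ _ x (by
      linarith [abs_nonneg (η s x), abs_nonneg (deriv (fun y => η s y) x), abs_nonneg (iteratedDeriv 2 (fun y => η s y) x), abs_nonneg (iteratedDeriv 3 (fun y => η s y) x), abs_nonneg (v s x), abs_nonneg (deriv (fun y => v s y) x), abs_nonneg (iteratedDeriv 2 (fun y => v s y) x), abs_nonneg (deriv (fun r => η r x) s), abs_nonneg (deriv (fun r => v r x) s)]) (hRd s hs x hx))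
  obtain ⟨Cvt, hCvt0, hCvt⟩ := unif_bound J hJ (fun s x => deriv (fun r => v r x) s)
    (hvt_cont.mono hsub) R
    (fun s hs x hx => small s _ _ x (by
      linarith [abs_nonneg (η s x), abs_nonneg (deriv (fun y => η s y) x), abs_nonneg (iteratedDeriv 2 (fun y => η s y) x), abs_nonneg (iteratedDeriv 3 (fun y => η s y) x), abs_nonneg (v s x), abs_nonneg (deriv (fun y => v s y) x), abs_nonneg (iteratedDeriv 2 (fun y => v s y) x), abs_nonneg (deriv (fun r => η r x) s), abs_nonneg (deriv (fun r => v r x) s)]) (hRd s hs x hx))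
  obtain ⟨M, hM⟩ := hJ.exists_bound_of_continuousOn (hR'.mono hρI)
  have hM0 : 0 ≤ M := (norm_nonneg _).trans (hM t htJ)
  have hinv1 : ∀ x : ℝ, (1 + x ^ 2)⁻¹ ≤ 1 := fun x => inv_le_one_of_one_le₀ (by nlinarith [sq_nonneg x])
  have hinv0 : ∀ x : ℝ, 0 ≤ (1 + x ^ 2)⁻¹ := fun x => by positivity
  have hprod : ∀ (a b A B x : ℝ), 0 ≤ A → 0 ≤ B → |a| ≤ A * (1 + x ^ 2)⁻¹ →
      |b| ≤ B * (1 + x ^ 2)⁻¹ → |a * b| ≤ A * B * (1 + x ^ 2)⁻¹ := by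
    intro a b A B x hA hB h1 h2
    rw [abs_mul]
    have h3 : |b| ≤ B := h2.trans (mul_le_of_le_one_right hB (hinv1 x))
    calc |a| * |b| ≤ (A * (1 + x ^ 2)⁻¹) * B :=
          mul_le_mul h1 h3 (abs_nonneg _) (mul_nonneg hA (hinv0 x))
      _ = _ := by ring
  have hc0c : Continuous (cutoff τ) :=
    continuous_iff_continuousAt.2 fun x => (hasDerivAt_cut0 τ x).continuousAt
  have hc1c : Continuous (cut1 τ) :=
    continuous_iff_continuousAt.2 fun x => (hasDerivAt_cut1 τ x).continuousAt
  have hηc : ∀ s ∈ I, Continuous (η s) := fun s hs => (hηx s hs).continuous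
  have hvc : ∀ s ∈ I, Continuous (v s) := fun s hs => (hvx s hs).continuous
  have hslice : Continuous (fun x : ℝ => (t, x)) := by fun_prop
  have hetc : Continuous (fun x => deriv (fun r => η r x) t) :=
    hηt_cont.comp_continuous hslice (fun x => ⟨ht, Set.mem_univ _⟩)
  have hvtc : Continuous (fun x => deriv (fun r => v r x) t) :=
    hvt_cont.comp_continuous hslice (fun x => ⟨ht, Set.mem_univ _⟩)
  have hηct := hηc t ht
  have hvct := hvc t ht
  obtain ⟨hAint, hder⟩ := hasDerivAt_integral_of_dominated_loc_of_deriv_le (μ := volume) (s := J)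
    (x₀ := t) (F := fun s x => η s x * v s x * cutoff τ (x - Rtil s))
    (F' := fun s x => (deriv (fun r => η r x) s * v s x + η s x * deriv (fun r => v r x) s)
      * cutoff τ (x - Rtil s) - η s x * v s x * (cut1 τ (x - Rtil s) * deriv Rtil s))
    (bound := fun x => (Cet * Cv + Ce * Cvt + Ce * Cv * (|τ / 4| * M)) * (1 + x ^ 2)⁻¹)
    hJn
    (by
      filter_upwards [hI.mem_nhds ht] with s hs
      have h1 := hηc s hs
      have h2 := hvc s hs
      exact Continuous.aestronglyMeasurable (by fun_prop))
    (by
      refine (integrable_inv_one_add_sq.const_mul (Ce * Cv)).mono'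
        (Continuous.aestronglyMeasurable (by fun_prop)) (Eventually.of_forall fun x => ?_)
      rw [Real.norm_eq_abs, abs_mul]
      exact (mul_le_of_le_one_right (abs_nonneg _) (cut0_bound _ _)).trans
        (hprod _ _ _ _ x hCe0 hCv0 (hCe t htJ x) (hCv t htJ x)))
    (Continuous.aestronglyMeasurable (by fun_prop))
    (Eventually.of_forall fun x s hs => by
      have b1 := hprod _ _ _ _ x hCet0 hCv0 (hCet s hs x) (hCv s hs x)
      have b2 := hprod _ _ _ _ x hCe0 hCvt0 (hCe s hs x) (hCvt s hs x)
      have b3 := hprod _ _ _ _ x hCe0 hCv0 (hCe s hs x) (hCv s hs x)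
      have b4 : |cut1 τ (x - Rtil s) * deriv Rtil s| ≤ |τ / 4| * M := by
        rw [abs_mul]
        exact mul_le_mul (cut1_bound _ _) (hM s hs) (abs_nonneg _) (abs_nonneg _)
      have b5 := mul_le_mul b3 b4 (abs_nonneg _)
        (mul_nonneg (mul_nonneg hCe0 hCv0) (hinv0 x))
      rw [← abs_mul] at b5
      have b6 : |(deriv (fun r => η r x) s * v s x + η s x * deriv (fun r => v r x) s)
          * cutoff τ (x - Rtil s)|
          ≤ |deriv (fun r => η r x) s * v s x| + |η s x * deriv (fun r => v r x) s| := by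
        rw [abs_mul]
        exact (mul_le_of_le_one_right (abs_nonneg _) (cut0_bound _ _)).trans (abs_add_le _ _)
      rw [Real.norm_eq_abs]
      refine (abs_sub _ _).trans ?_
      calc _ ≤ _ := add_le_add (b6.trans (add_le_add b1 b2)) b5
        _ = _ := by ring)
    (integrable_inv_one_add_sq.const_mul _)
    (Eventually.of_forall fun x s hs => by
      have d1 := (hηt x s (hρI hs)).hasDerivAt
      have d2 := (hvt x s (hρI hs)).hasDerivAt
      have d3 := (hR s (hρI hs)).hasDerivAt.const_sub x
      have d4 := (hasDerivAt_cut0 τ (x - Rtil s)).comp s d3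
      refine ((d1.fun_mul d2).fun_mul d4).congr_deriv ?_
      simp only [Function.comp_apply]
      ring)
  refine (hder.const_mul (1 / 2)).congr_deriv ?_
  -- the spatial part at fixed time
  have hη3 := hηx t ht
  have hv2 := hvx t ht
  have he : ∀ x, HasDerivAt (η t) (deriv (fun y => η t y) x) x := fun x =>
    (hη3.differentiable (by norm_num) x).hasDerivAt
  have he1 : ∀ x, HasDerivAt (fun x => deriv (fun y => η t y) x)
      (iteratedDeriv 2 (fun y => η t y) x) x := fun x => by
    have h := (hη3.differentiable_iteratedDeriv 1 (by norm_num) x).hasDerivAt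
    rw [← iteratedDeriv_succ, iteratedDeriv_one] at h
    exact h
  have he2 : ∀ x, HasDerivAt (fun x => iteratedDeriv 2 (fun y => η t y) x)
      (iteratedDeriv 3 (fun y => η t y) x) x := fun x => by
    have h := (hη3.differentiable_iteratedDeriv 2 (by norm_num) x).hasDerivAt
    rw [← iteratedDeriv_succ] at h
    exact h
  have hw : ∀ x, HasDerivAt (v t) (deriv (fun y => v t y) x) x := fun x =>
    (hv2.differentiable (by norm_num) x).hasDerivAt
  have hsh : ∀ x, HasDerivAt (fun y => y - Rtil t) 1 x := fun x => (hasDerivAt_id x).sub_const _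
  have hΦ := core_deriv f hf (η t) (fun x => deriv (fun y => η t y) x)
    (fun x => iteratedDeriv 2 (fun y => η t y) x) (fun x => iteratedDeriv 3 (fun y => η t y) x)
    (v t) (fun x => deriv (fun y => v t y) x) (fun x => deriv (fun r => η r x) t)
    (fun x => deriv (fun r => v r x) t)
    (fun x => cutoff τ (x - Rtil t)) (fun x => cut1 τ (x - Rtil t))
    (fun x => cut2 τ (x - Rtil t)) (fun x => cut3 τ (x - Rtil t))
    he he1 he2 hw (hlt t ht) (fun x => (hsol t ht x).1) (fun x => (hsol t ht x).2)
    (fun x => (hasDerivAt_cut0 τ (x - Rtil t)).comp_sub_const x (Rtil t))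
    (fun x => (hasDerivAt_cut1 τ (x - Rtil t)).comp_sub_const x (Rtil t))
    (fun x => (hasDerivAt_cut2 τ (x - Rtil t)).comp_sub_const x (Rtil t))
    (deriv Rtil t)
  have te := tendsto_of_bound _ _ (hCe t htJ)
  have te1 := tendsto_of_bound _ _ (hCe1 t htJ)
  have te2 := tendsto_of_bound _ _ (hCe2 t htJ)
  have tv := tendsto_of_bound _ _ (hCv t htJ)
  have hlim := core_tendsto f hf (η t) (fun x => deriv (fun y => η t y) x)
    (fun x => iteratedDeriv 2 (fun y => η t y) x) (v t)
    (fun x => cutoff τ (x - Rtil t)) (fun x => cut1 τ (x - Rtil t))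
    (fun x => cut2 τ (x - Rtil t)) (cocompact ℝ) (1 + |τ / 4| + τ ^ 2 / 4) te te1 te2 tv
    (fun x => (cut0_bound τ _).trans (by linarith [abs_nonneg (τ / 4), sq_nonneg τ]))
    (fun x => (cut1_bound τ _).trans (by linarith [abs_nonneg (τ / 4), sq_nonneg τ]))
    (fun x => (cut2_bound τ _).trans (by linarith [abs_nonneg (τ / 4), sq_nonneg τ]))
  have hBint := core_integrable f hf (η t) (fun x => deriv (fun y => η t y) x) (v t)
    (fun x => cut1 τ (x - Rtil t)) (fun x => cut3 τ (x - Rtil t)) (deriv Rtil t)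
    hηct (continuous_iff_continuousAt.2 fun x => (he1 x).continuousAt) hvct (hlt t ht) te te1 tv
    ((integrable_cut1 τ hτ).comp_sub_right _) ((integrable_cut3 τ hτ).comp_sub_right _)
  have hzero := integral_of_hasDerivAt_of_tendsto hΦ (hBint.sub (hAint.const_mul (1 / 2)))
    (hlim.mono_left atBot_le_cocompact) (hlim.mono_left atTop_le_cocompact)
  rw [integral_sub hBint (hAint.const_mul (1 / 2)), MeasureTheory.integral_const_mul] at hzero
  rw [deriv_cutoff, iteratedDeriv_cutoff]
  linarith [hzero]

end
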